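/- arXiv:0708.2154 — 2 statements merged into one kernel-verified Lean document; each statement's English description precedes it below -/
import Mathlib

section
/- Let n ≥ 1 and m ≥ 1 be real, and let p : ℝⁿ → ℂ be a C¹ function such that |p(ζ)| ≤ C₀⟨ζ⟩^m and |∇p(ζ)| ≤ C₀⟨ζ⟩^{m−1} for all ζ ∈ ℝⁿ, for some C₀ > 0. Then there exists a constant C > 0 such that |p(ξ+η) − p(ξ) − p(η)| ≤ C ⟨ξ⟩^{m−1} ⟨η⟩ for all ξ, η ∈ ℝⁿ with |ξ| ≥ |η|. -/
open scoped Real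

noncomputable section

abbrev Euc (n : ℕ) := EuclideanSpace ℝ (Fin n)

/-- Japanese bracket `⟨x⟩ = (1+|x|²)^{1/2}`. -/
def jap {n : ℕ} (x : Euc n) : ℝ := Real.sqrt (1 + ‖x‖ ^ 2)

end

theorem one_le_jap {n : ℕ} (x : Euc n) : 1 ≤ jap x :=
  Real.one_le_sqrt.2 (by nlinarith [sq_nonneg ‖x‖])

theorem norm_le_jap {n : ℕ} (x : Euc n) : ‖x‖ ≤ jap x :=
  Real.le_sqrt_of_sq_le (by linarith)

theorem jap_le_jap {n : ℕ} {x y : Euc n} (h : ‖x‖ ≤ ‖y‖) : jap x ≤ jap y :=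
  Real.sqrt_le_sqrt (by gcongr)

theorem jap_le_two_mul_jap {n : ℕ} {x y : Euc n} (h : ‖x‖ ≤ 2 * ‖y‖) :
    jap x ≤ 2 * jap y := by
  have hy : jap y ^ 2 = 1 + ‖y‖ ^ 2 := Real.sq_sqrt (by positivity)
  refine Real.sqrt_le_iff.2 ⟨by linarith [one_le_jap y], ?_⟩
  nlinarith [norm_nonneg x]

/-- Let `m ≥ 1` and let `p : ℝⁿ → ℂ` be a `C¹` function with
`|p(ζ)| ≤ C₀⟨ζ⟩^m` and `|∇p(ζ)| ≤ C₀⟨ζ⟩^{m-1}`. Then there is `C > 0` with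
`|p(ξ+η) − p(ξ) − p(η)| ≤ C⟨ξ⟩^{m-1}⟨η⟩` whenever `|ξ| ≥ |η|`. -/
theorem statement2 (n : ℕ) (hn : 1 ≤ n) (m : ℝ) (hm : 1 ≤ m)
    (p : Euc n → ℂ) (C₀ : ℝ) (hC₀ : 0 < C₀) (hp : ContDiff ℝ 1 p)
    (hbound : ∀ ζ : Euc n, ‖p ζ‖ ≤ C₀ * jap ζ ^ m)
    (hgrad : ∀ ζ : Euc n, ‖fderiv ℝ p ζ‖ ≤ C₀ * jap ζ ^ (m - 1)) :
    ∃ C : ℝ, 0 < C ∧ ∀ ξ η : Euc n, ‖η‖ ≤ ‖ξ‖ →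
      ‖p (ξ + η) - p ξ - p η‖ ≤ C * jap ξ ^ (m - 1) * jap η := by
  refine ⟨C₀ * (2 ^ (m - 1) + 1), by positivity, fun ξ η h => ?_⟩
  have hm' : 0 ≤ m - 1 := by linarith
  have hξ : 0 < jap ξ := one_pos.trans_le (one_le_jap ξ)
  have hη : 0 < jap η := one_pos.trans_le (one_le_jap η)
  have hdiff : ‖p (ξ + η) - p ξ‖ ≤ C₀ * (2 ^ (m - 1) * jap ξ ^ (m - 1)) * jap η := by
    have hmem : ξ + η ∈ Metric.closedBall (0 : Euc n) (2 * ‖ξ‖) := by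
      rw [mem_closedBall_zero_iff]
      linarith [norm_add_le ξ η]
    have hmem' : ξ ∈ Metric.closedBall (0 : Euc n) (2 * ‖ξ‖) := by
      rw [mem_closedBall_zero_iff]
      linarith [norm_nonneg ξ]
    have hmvt := (convex_closedBall (0 : Euc n) (2 * ‖ξ‖)).norm_image_sub_le_of_norm_fderiv_le
      (𝕜 := ℝ) (f := p) (C := C₀ * (2 ^ (m - 1) * jap ξ ^ (m - 1)))
      (fun x _ => hp.differentiable one_ne_zero x)
      (fun x hx => by
        rw [mem_closedBall_zero_iff] at hx
        refine (hgrad x).trans ?_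
        rw [← Real.mul_rpow zero_le_two hξ.le]
        have hx0 : 0 ≤ jap x := zero_le_one.trans (one_le_jap x)
        gcongr
        exact jap_le_two_mul_jap hx) hmem' hmem
    rw [add_sub_cancel_left] at hmvt
    refine hmvt.trans ?_
    gcongr
    exact norm_le_jap η
  have hpη : ‖p η‖ ≤ C₀ * jap ξ ^ (m - 1) * jap η := by
    have hsplit : jap η ^ m = jap η ^ (m - 1) * jap η := by
      rw [← Real.rpow_add_one hη.ne', sub_add_cancel]
    refine (hbound η).trans ?_
    rw [hsplit, ← mul_assoc]
    gcongr
    exact jap_le_jap h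
  calc ‖p (ξ + η) - p ξ - p η‖ ≤ ‖p (ξ + η) - p ξ‖ + ‖p η‖ := norm_sub_le _ _
    _ ≤ C₀ * (2 ^ (m - 1) * jap ξ ^ (m - 1)) * jap η + C₀ * jap ξ ^ (m - 1) * jap η :=
        add_le_add hdiff hpη
    _ = C₀ * (2 ^ (m - 1) + 1) * jap ξ ^ (m - 1) * jap η := by ring
end

section
/- For any n ≥ 1, p ≥ 1 and multi-indices α, α¹, …, α^p ∈ ℕⁿ satisfying α = α¹ + ⋯ + α^p, one has the identity (as rational numbers) |α|!/α! = ∑ ∏_{j=1}^p |α^j|!/γ^j!, where the sum is over all p-tuples of multi-indices (γ¹, …, γ^p) with γ¹ + ⋯ + γ^p = α and |γ^j| = |α^j| for every j. -/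
open Finset
open scoped Nat

/-- Length `|α|` of a multi-index. -/
def deg {n : ℕ} (α : Fin n → ℕ) : ℕ := ∑ i, α i

/-- Factorial `α!` of a multi-index. -/
def mfact {n : ℕ} (α : Fin n → ℕ) : ℕ := ∏ i, (α i)!

lemma coeff_sum_X_pow_eq_factorial_div {n : ℕ} (γ : Fin n → ℕ) (d : ℕ) :
    MvPolynomial.coeff (Finsupp.equivFunOnFinite.symm γ)
        ((∑ i, MvPolynomial.X i : MvPolynomial (Fin n) ℚ) ^ d) =
      if deg γ = d then (d ! : ℚ) / (mfact γ : ℚ) else 0 := by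
  have hdeg : ((Finsupp.equivFunOnFinite.symm γ).sum fun _ m ↦ m) = deg γ := by
    simp [Finsupp.sum_fintype, deg]
  rw [MvPolynomial.coeff_sum_X_pow_of_fintype, hdeg]
  split_ifs with h
  · have hfact : (mfact γ : ℚ) ≠ 0 :=
      Nat.cast_ne_zero.2 (prod_ne_zero_iff.2 fun i _ ↦ (γ i).factorial_ne_zero)
    rw [Finsupp.multinomial_eq_of_support_subset (subset_univ _), eq_div_iff hfact, ← h, mul_comm]
    exact_mod_cast Nat.multinomial_spec univ γ
  · simp

lemma MvPolynomial.coeff_prod_eq_sum_finsuppAntidiag {σ ι R : Type*} [CommSemiring R]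
    [DecidableEq σ] [DecidableEq ι] (f : ι → MvPolynomial σ R) (d : σ →₀ ℕ) (s : Finset ι) :
    MvPolynomial.coeff d (∏ j ∈ s, f j) =
      ∑ l ∈ finsuppAntidiag s d, ∏ i ∈ s, MvPolynomial.coeff (l i) (f i) := by
  have h := MvPowerSeries.coeff_prod (fun j ↦ (f j : MvPowerSeries σ R)) d s
  simp only [← MvPolynomial.coeToMvPowerSeries.ringHom_apply, ← map_prod] at h
  simpa only [MvPolynomial.coeToMvPowerSeries.ringHom_apply, MvPolynomial.coeff_coe] using h

/-- If `α = α¹ + ⋯ + α^p` then, as rational numbers,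
`|α|!/α! = ∑ ∏_j |α^j|!/γ^j!`, the sum being over all `p`-tuples of multi-indices
`(γ¹, …, γ^p)` with `γ¹ + ⋯ + γ^p = α` and `|γ^j| = |α^j|` for all `j`. -/
theorem statement7 (n p : ℕ) (hn : 1 ≤ n) (hp : 1 ≤ p)
    (α : Fin n → ℕ) (A : Fin p → Fin n → ℕ) (hsum : α = ∑ j, A j) :
    ((deg α)! : ℚ) / (mfact α : ℚ) =
      ∑ γ ∈ (Fintype.piFinset fun _ : Fin p =>
          Fintype.piFinset fun i : Fin n => Finset.range (α i + 1)).filter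
            (fun γ => (∑ j, γ j) = α ∧ ∀ j, deg (γ j) = deg (A j)),
        ∏ j, ((deg (A j))! : ℚ) / (mfact (γ j) : ℚ) := by
  classical
  have hdeg : deg α = ∑ j, deg (A j) := by
    simp only [hsum, deg, Finset.sum_apply]
    exact sum_comm
  have hcoeff := coeff_sum_X_pow_eq_factorial_div α (deg α)
  rw [if_pos rfl] at hcoeff
  rw [← hcoeff, hdeg, ← prod_pow_eq_pow_sum, MvPolynomial.coeff_prod_eq_sum_finsuppAntidiag]
  symm
  refine sum_of_injOn
    (fun γ ↦ Finsupp.equivFunOnFinite.symm fun j ↦ Finsupp.equivFunOnFinite.symm (γ j))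
    ?_ ?_ ?_ ?_
  · intro γ _ δ _ h
    funext j i
    simpa using DFunLike.congr_fun (DFunLike.congr_fun h j) i
  · intro γ hγ
    have hγα := (mem_filter.1 hγ).2.1
    simp only [mem_coe, mem_finsuppAntidiag, subset_univ, and_true]
    ext i
    simp [← hγα, Finsupp.finsetSum_apply]
  · intro l hl hnot
    by_contra hne
    refine hnot ⟨fun j ↦ ⇑(l j), ?_, by ext; rfl⟩
    have hlα : ∑ j, ⇑(l j) = α := by
      funext i
      simpa [Finsupp.finsetSum_apply] using DFunLike.congr_fun (mem_finsuppAntidiag.1 hl).1 i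
    rw [mem_coe, mem_filter]
    refine ⟨?_, hlα, fun j ↦ ?_⟩
    · simp only [Fintype.mem_piFinset, mem_range, Nat.lt_succ_iff]
      intro j i
      rw [← hlα, Finset.sum_apply]
      exact single_le_sum (f := fun j ↦ l j i) (fun _ _ ↦ Nat.zero_le _) (mem_univ j)
    · by_contra hj
      refine prod_ne_zero_iff.1 hne j (mem_univ j) ?_
      have h := coeff_sum_X_pow_eq_factorial_div (l j) (deg (A j))
      rwa [if_neg hj, Finsupp.equivFunOnFinite_symm_coe] at h
  · intro γ hγ
    refine prod_congr rfl fun j _ ↦ ?_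
    have h := coeff_sum_X_pow_eq_factorial_div (γ j) (deg (A j))
    rw [if_pos ((mem_filter.1 hγ).2.2 j)] at h
    exact h.symm
end
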